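/- arXiv:1508.05403 — 2 statements merged into one kernel-verified Lean document; each statement's English description precedes it below -/
import Mathlib

section
/- Let Γ be a finite simple graph with vertex set S, let a, d ∈ S be distinct vertices with St(d) ⊆ St(a), let φ be the transvection with acting letter a and domain d, and let G = W_Γ ⋊_φ (ℤ/2ℤ). Then for every finite simple graph Δ there is no injective group homomorphism from G into the right-angled Coxeter group W_Δ; in particular, G is not isomorphic to any right-angled Coxeter group. -/
open Classical in
/-- The Coxeter matrix of the right-angled Coxeter group `W_Γ` associated to a
finite simple graph `Γ`: diagonal entries are `1`, entries of adjacent pairs are `2`,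
and entries of distinct non-adjacent pairs are `0` (representing infinity). -/
noncomputable def racgMatrix {V : Type*} (Γ : SimpleGraph V) : CoxeterMatrix V where
  M := Matrix.of fun s t => if s = t then 1 else if Γ.Adj s t then 2 else 0
  isSymm := Matrix.IsSymm.ext fun s t => by
    by_cases h : s = t
    · subst h; rfl
    · simp [h, Ne.symm h, Γ.adj_comm]
  diagonal i := by simp
  off_diagonal i j h := by
    simp only [Matrix.of_apply, if_neg h]
    split <;> simp

/-- The star of a vertex `a`: the vertex `a` together with its neighbours. -/
def graphStar {V : Type*} (Γ : SimpleGraph V) (a : V) : Set V :=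
  {s | s = a ∨ Γ.Adj a s}

/-- The homomorphism out of a right-angled Coxeter group determined by a family of elements
squaring to one, commuting whenever the corresponding vertices are adjacent. -/
noncomputable def racgLift {V G : Type*} [Monoid G] (Γ : SimpleGraph V) (f : V → G)
    (hsq : ∀ s, f s * f s = 1) (hcomm : ∀ s t, Γ.Adj s t → f s * f t = f t * f s) :
    (racgMatrix Γ).Group →* G :=
  (racgMatrix Γ).toCoxeterSystem.lift ⟨f, fun s t => by
    by_cases hst : s = t
    · subst hst
      simp [hsq]
    by_cases hadj : Γ.Adj s t
    · have hM : racgMatrix Γ s t = 2 := by simp [racgMatrix, hst, hadj]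
      rw [hM, pow_two, mul_assoc, ← mul_assoc (f t), ← hcomm s t hadj, mul_assoc (f s), hsq,
        mul_one, hsq]
    · have hM : racgMatrix Γ s t = 0 := by simp [racgMatrix, hst, hadj]
      rw [hM, pow_zero]⟩

@[simp]
theorem racgLift_simple {V G : Type*} [Monoid G] (Γ : SimpleGraph V) (f : V → G)
    (hsq : ∀ s, f s * f s = 1) (hcomm : ∀ s t, Γ.Adj s t → f s * f t = f t * f s) (s : V) :
    racgLift Γ f hsq hcomm ((racgMatrix Γ).simple s) = f s := by
  rw [← CoxeterMatrix.toCoxeterSystem_simple]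
  exact CoxeterSystem.lift_apply_simple _ _ s

theorem racg_simple_mul_self {V : Type*} (Γ : SimpleGraph V) (s : V) :
    (racgMatrix Γ).simple s * (racgMatrix Γ).simple s = 1 :=
  (racgMatrix Γ).toCoxeterSystem.simple_mul_simple_self s

theorem racg_simple_ne_one {V : Type*} (Γ : SimpleGraph V) (s : V) :
    (racgMatrix Γ).simple s ≠ 1 := by
  intro h
  have := (racgMatrix Γ).toCoxeterSystem.length_simple s
  rw [CoxeterMatrix.toCoxeterSystem_simple, h, CoxeterSystem.length_one] at this
  exact zero_ne_one this

theorem racg_simple_comm {V : Type*} (Γ : SimpleGraph V) {s t : V} (h : Γ.Adj s t) :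
    (racgMatrix Γ).simple s * (racgMatrix Γ).simple t =
      (racgMatrix Γ).simple t * (racgMatrix Γ).simple s := by
  have hM : racgMatrix Γ s t = 2 := by simp [racgMatrix, h.ne, h]
  have hpow := (racgMatrix Γ).toCoxeterSystem.simple_mul_simple_pow s t
  rw [CoxeterMatrix.toCoxeterSystem_simple, hM, pow_two] at hpow
  rw [eq_inv_of_mul_eq_one_left hpow, mul_inv_rev,
    inv_eq_of_mul_eq_one_left (racg_simple_mul_self Γ s),
    inv_eq_of_mul_eq_one_left (racg_simple_mul_self Γ t)]

theorem racg_hom_ext {V G : Type*} [Monoid G] {Γ : SimpleGraph V}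
    {f g : (racgMatrix Γ).Group →* G}
    (h : ∀ s, f ((racgMatrix Γ).simple s) = g ((racgMatrix Γ).simple s)) : f = g :=
  (racgMatrix Γ).toCoxeterSystem.ext_simple fun s => by
    simpa only [CoxeterMatrix.toCoxeterSystem_simple] using h s

/-- The homomorphism from the group of signs sending `-1` to a given involution. -/
def signsLift {G : Type*} [Monoid G] (x : G) (hx : x * x = 1) : ℤˣ →* G where
  toFun u := if u = 1 then 1 else x
  map_one' := by simp
  map_mul' u v := by
    rcases Int.units_eq_one_or u with rfl | rfl <;>
      rcases Int.units_eq_one_or v with rfl | rfl <;> simp [hx]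

@[simp]
theorem signsLift_neg_one {G : Type*} [Monoid G] (x : G) (hx : x * x = 1) :
    signsLift x hx (-1) = x := by
  simp [signsLift]

/-- The automorphism of a free group inverting each free generator. -/
def freeGroupInvertGenerators (I : Type*) : MulAut (FreeGroup I) :=
  MonoidHom.toMulEquiv (FreeGroup.lift fun i => (FreeGroup.of i)⁻¹)
    (FreeGroup.lift fun i => (FreeGroup.of i)⁻¹) (by ext; simp) (by ext; simp)

@[simp]
theorem freeGroupInvertGenerators_of {I : Type*} (i : I) :
    freeGroupInvertGenerators I (FreeGroup.of i) = (FreeGroup.of i)⁻¹ := by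
  simp [freeGroupInvertGenerators]

theorem freeGroupInvertGenerators_mul_self (I : Type*) :
    freeGroupInvertGenerators I * freeGroupInvertGenerators I = 1 := by
  apply MulEquiv.toMonoidHom_injective
  ext i
  simp

/-- The number of occurrences of a vertex in an element of a right-angled Coxeter group,
modulo two, written as a sign. -/
noncomputable def racgVertexSign {V : Type*} (Γ : SimpleGraph V) (v : V) :
    (racgMatrix Γ).Group →* ℤˣ :=
  open Classical in
  racgLift Γ (fun s => if s = v then -1 else 1) (fun _ => Int.units_mul_self _)
    (fun _ _ _ => mul_comm _ _)

/-- The length of an element of a right-angled Coxeter group, modulo two, written as a sign. -/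
noncomputable def racgSign {V : Type*} (Γ : SimpleGraph V) : (racgMatrix Γ).Group →* ℤˣ :=
  racgLift Γ (fun _ => -1) (fun _ => Int.units_mul_self _) (fun _ _ _ => rfl)

@[simp]
theorem racgSign_simple {V : Type*} (Γ : SimpleGraph V) (s : V) :
    racgSign Γ ((racgMatrix Γ).simple s) = -1 := by
  simp [racgSign]

/-- The group generated by freely independent involutions indexed by `I`, mapped to the extension
of a free group by the automorphism inverting the generators. -/
noncomputable def freeInvolutionsToSemidirect (I : Type*) :
    (racgMatrix (⊥ : SimpleGraph I)).Group →*
      FreeGroup I ⋊[signsLift _ (freeGroupInvertGenerators_mul_self I)] ℤˣ :=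
  racgLift _ (fun i => ⟨FreeGroup.of i, -1⟩)
    (fun i => by ext <;> simp) (fun _ _ h => h.elim)

theorem freeInvolutionsToSemidirect_injective (I : Type*) :
    Function.Injective (freeInvolutionsToSemidirect I) := by
  rcases isEmpty_or_nonempty I with hI | ⟨⟨i₀⟩⟩
  · have h : MonoidHom.id (racgMatrix (⊥ : SimpleGraph I)).Group = 1 :=
      racg_hom_ext fun s => hI.elim s
    intro x y _
    exact (DFunLike.congr_fun h x).trans (DFunLike.congr_fun h y).symm
  · let s := (racgMatrix (⊥ : SimpleGraph I)).simple
    have hs (i : I) : s i * s i = 1 := racg_simple_mul_self _ i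
    have hs' (i : I) : (s i)⁻¹ = s i := inv_eq_of_mul_eq_one_left (hs i)
    let r : FreeGroup I ⋊[signsLift _ (freeGroupInvertGenerators_mul_self I)] ℤˣ →*
        (racgMatrix (⊥ : SimpleGraph I)).Group :=
      SemidirectProduct.lift (FreeGroup.lift fun i => s i * s i₀) (signsLift (s i₀) (hs i₀))
        (fun u => by
          rcases Int.units_eq_one_or u with rfl | rfl
          · ext; simp
          · ext i
            simp [hs', mul_assoc, hs])
    have hr : r.comp (freeInvolutionsToSemidirect I) = MonoidHom.id _ := by
      refine racg_hom_ext fun i => ?_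
      have : (⟨FreeGroup.of i, -1⟩ :
          FreeGroup I ⋊[signsLift _ (freeGroupInvertGenerators_mul_self I)] ℤˣ) =
          SemidirectProduct.inl (FreeGroup.of i) * SemidirectProduct.inr (-1) := by
        ext <;> simp
      simp only [freeInvolutionsToSemidirect, MonoidHom.comp_apply, racgLift_simple, this, map_mul,
        r, SemidirectProduct.lift_inl, SemidirectProduct.lift_inr, FreeGroup.lift_apply_of,
        signsLift_neg_one, MonoidHom.id_apply, mul_assoc, hs, mul_one]
      rfl
    exact Function.LeftInverse.injective (g := r) fun x => DFunLike.congr_fun hr x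

/-- The even elements of a group generated by freely independent involutions are torsion-free. -/
theorem freeInvolutions_eq_one {I : Type*} (x : (racgMatrix (⊥ : SimpleGraph I)).Group)
    (hx : x * x = 1) (hsign : racgSign _ x = 1) : x = 1 := by
  set y := freeInvolutionsToSemidirect I x with hy
  have hright : y.right = 1 := by
    rw [← hsign]
    have : SemidirectProduct.rightHom.comp (freeInvolutionsToSemidirect I) = racgSign _ :=
      racg_hom_ext fun i => by simp [freeInvolutionsToSemidirect]
    exact DFunLike.congr_fun this x
  have hyy : y * y = 1 := by rw [hy, ← map_mul, hx, map_one]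
  have hleft : y.left * y.left = 1 := by
    simpa [hright] using congrArg SemidirectProduct.left hyy
  have hleft' : y.left = 1 := by
    rw [← pow_two] at hleft
    exact (pow_eq_one_iff_left two_ne_zero).mp hleft
  apply freeInvolutionsToSemidirect_injective
  rw [map_one, ← hy]
  ext <;> simp [hleft', hright]

/-- The endomorphism of a right-angled Coxeter group killing the vertices outside `T`. -/
noncomputable def racgRetract {V : Type*} (Γ : SimpleGraph V) (T : Set V) :
    (racgMatrix Γ).Group →* (racgMatrix Γ).Group :=
  open Classical in
  racgLift Γ (fun s => if s ∈ T then (racgMatrix Γ).simple s else 1)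
    (fun s => by split_ifs <;> simp [racg_simple_mul_self])
    (fun s t h => by split_ifs <;> simp [racg_simple_comm Γ h])

theorem conj_mul_self_eq_one {G : Type*} [Group G] (g : G) {w : G} (hw : w * w = 1) :
    g * w * g⁻¹ * (g * w * g⁻¹) = 1 := by
  rw [conj_mul, hw, mul_one, mul_inv_cancel]

/-- The endomorphism, induced by conjugation by `g`, of the group freely generated by involutions
indexed by the elements of order at most two. -/
noncomputable def conjFreeInvolutionsHom {G : Type*} [Group G] (g : G) :
    (racgMatrix (⊥ : SimpleGraph {w : G // w * w = 1})).Group →*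
      (racgMatrix (⊥ : SimpleGraph {w : G // w * w = 1})).Group :=
  racgLift _ (fun w => (racgMatrix _).simple ⟨g * w * g⁻¹, conj_mul_self_eq_one g w.2⟩)
    (fun _ => racg_simple_mul_self _ _) (fun _ _ h => h.elim)

@[simp]
theorem conjFreeInvolutionsHom_simple {G : Type*} [Group G] (g : G) (w : {w : G // w * w = 1}) :
    conjFreeInvolutionsHom g ((racgMatrix _).simple w) =
      (racgMatrix _).simple ⟨g * w * g⁻¹, conj_mul_self_eq_one g w.2⟩ := by
  simp [conjFreeInvolutionsHom]

theorem conjFreeInvolutionsHom_one (G : Type*) [Group G] :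
    conjFreeInvolutionsHom (1 : G) = MonoidHom.id _ :=
  racg_hom_ext fun w => by simp

theorem conjFreeInvolutionsHom_mul {G : Type*} [Group G] (g h : G) :
    conjFreeInvolutionsHom (g * h) = (conjFreeInvolutionsHom g).comp (conjFreeInvolutionsHom h) :=
  racg_hom_ext fun w => by simp [mul_assoc]

/-- The conjugation action of a group on the group freely generated by involutions indexed by
the elements of order at most two. -/
noncomputable def conjFreeInvolutions (G : Type*) [Group G] :
    G →* MulAut (racgMatrix (⊥ : SimpleGraph {w : G // w * w = 1})).Group where
  toFun g := MonoidHom.toMulEquiv (conjFreeInvolutionsHom g) (conjFreeInvolutionsHom g⁻¹)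
    (by rw [← conjFreeInvolutionsHom_mul, inv_mul_cancel, conjFreeInvolutionsHom_one])
    (by rw [← conjFreeInvolutionsHom_mul, mul_inv_cancel, conjFreeInvolutionsHom_one])
  map_one' := MulEquiv.toMonoidHom_injective (conjFreeInvolutionsHom_one G)
  map_mul' g h := MulEquiv.toMonoidHom_injective (conjFreeInvolutionsHom_mul g h)

@[simp]
theorem conjFreeInvolutions_simple {G : Type*} [Group G] (g : G) (w : {w : G // w * w = 1}) :
    conjFreeInvolutions G g ((racgMatrix _).simple w) =
      (racgMatrix _).simple ⟨g * w * g⁻¹, conj_mul_self_eq_one g w.2⟩ :=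
  conjFreeInvolutionsHom_simple g w

/-- The homomorphism sending each free involution to the element indexing it. -/
noncomputable def freeInvolutionsEval (G : Type*) [Group G] :
    (racgMatrix (⊥ : SimpleGraph {w : G // w * w = 1})).Group →* G :=
  racgLift _ (fun w => w.1) (fun w => w.2) (fun _ _ h => h.elim)

@[simp]
theorem freeInvolutionsEval_simple {G : Type*} [Group G] (w : {w : G // w * w = 1}) :
    freeInvolutionsEval G ((racgMatrix _).simple w) = w := by
  simp [freeInvolutionsEval]

theorem freeInvolutionsEval_comp_conj {G : Type*} [Group G] (g : G) :
    (freeInvolutionsEval G).comp (conjFreeInvolutions G g).toMonoidHom =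
      (MulAut.conj g).toMonoidHom.comp (freeInvolutionsEval G) :=
  racg_hom_ext fun w => by simp

theorem racgSign_comp_conj {G : Type*} [Group G] (g : G) :
    (racgSign _).comp (conjFreeInvolutions G g).toMonoidHom = racgSign _ :=
  racg_hom_ext fun w => by simp

theorem racgRetract_insert_eq_one {V : Type*} (Γ : SimpleGraph V) {T : Set V} {v : V}
    (hv : v ∉ T) (g : (racgMatrix Γ).Group) (hg : g * g = 1) (hsign : racgVertexSign Γ v g = 1)
    (hT : racgRetract Γ T g = 1) : racgRetract Γ (insert v T) g = 1 := by
  classical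
  let W := (racgMatrix Γ).Group
  let I := {w : W // w * w = 1}
  let N := (racgMatrix (⊥ : SimpleGraph I)).Group
  let x : N := (racgMatrix (⊥ : SimpleGraph I)).simple
    ⟨(racgMatrix Γ).simple v, racg_simple_mul_self Γ v⟩
  have hx : x * x = 1 := racg_simple_mul_self _ _
  have hxeval : freeInvolutionsEval W x = (racgMatrix Γ).simple v := freeInvolutionsEval_simple _
  have hxsign : racgSign _ x = -1 := racgSign_simple _ _
  have hxs (s : V) (h : Γ.Adj s v) :
      conjFreeInvolutions W ((racgMatrix Γ).simple s) x = x :=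
    (conjFreeInvolutions_simple _ _).trans <| congrArg _ <| Subtype.ext <|
      mul_inv_eq_of_eq_mul (racg_simple_comm Γ h)
  have hcomm (s : V) (h : Γ.Adj s v) :
      (SemidirectProduct.inr ((racgMatrix Γ).simple s) * SemidirectProduct.inl x :
        N ⋊[conjFreeInvolutions W] W) =
      SemidirectProduct.inl x * SemidirectProduct.inr ((racgMatrix Γ).simple s) := by
    ext <;> simp [hxs s h]
  let Φ : W →* N ⋊[conjFreeInvolutions W] W :=
    racgLift Γ (fun s => if s = v then SemidirectProduct.inl x else
        if s ∈ T then SemidirectProduct.inr ((racgMatrix Γ).simple s) else 1)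
      (fun s => by
        split_ifs
        · rw [← map_mul, hx, map_one]
        · rw [← map_mul, racg_simple_mul_self, map_one]
        · rw [mul_one])
      (fun s t h => by
        split_ifs with h₁ h₂ h₃ h₄ h₅
        all_goals try simp only [mul_one, one_mul]
        · exact (hcomm t (h₁ ▸ h.symm)).symm
        · exact hcomm s (h₅ ▸ h)
        · rw [← map_mul, ← map_mul, racg_simple_comm Γ h])
  let Ψ : N ⋊[conjFreeInvolutions W] W →* W :=
    SemidirectProduct.lift (freeInvolutionsEval W) (MonoidHom.id W) freeInvolutionsEval_comp_conj
  let σ : N ⋊[conjFreeInvolutions W] W →* ℤˣ :=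
    SemidirectProduct.lift (racgSign _) 1 fun g => by
      rw [racgSign_comp_conj]
      ext
      simp
  have hΨΦ : Ψ.comp Φ = racgRetract Γ (insert v T) := racg_hom_ext fun s => by
    by_cases hs : s = v
    · subst hs
      simp [Φ, Ψ, racgRetract, hxeval]
    · by_cases hsT : s ∈ T <;> simp [Φ, Ψ, racgRetract, hs, hsT]
  have hΦright : SemidirectProduct.rightHom.comp Φ = racgRetract Γ T := racg_hom_ext fun s => by
    by_cases hs : s = v
    · subst hs
      simp [Φ, racgRetract, hv]
    · by_cases hsT : s ∈ T <;> simp [Φ, racgRetract, hs, hsT]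
  have hσΦ : σ.comp Φ = racgVertexSign Γ v := racg_hom_ext fun s => by
    by_cases hs : s = v
    · subst hs
      simp [Φ, σ, racgVertexSign, hxsign]
    · by_cases hsT : s ∈ T <;> simp [Φ, σ, racgVertexSign, hs, hsT]
  have hright : (Φ g).right = 1 := (DFunLike.congr_fun hΦright g).trans hT
  have hinl : Φ g = SemidirectProduct.inl (Φ g).left := by
    ext <;> simp [hright]
  have hleft : (Φ g).left = 1 := by
    apply freeInvolutions_eq_one
    · apply SemidirectProduct.inl_injective (φ := conjFreeInvolutions W)
      rw [map_mul, ← hinl, ← map_mul, hg, map_one, map_one]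
    · rw [← hsign, ← hσΦ, MonoidHom.comp_apply, hinl]
      simp [σ]
  rw [← hΨΦ, MonoidHom.comp_apply, hinl, hleft, map_one, map_one]

/-- An involution of a finitely generated right-angled Coxeter group that lies in the kernel of
the abelianization is trivial. -/
theorem racg_eq_one_of_mul_self {V : Type*} [Finite V] (Γ : SimpleGraph V)
    (g : (racgMatrix Γ).Group) (hg : g * g = 1) (hsign : ∀ v, racgVertexSign Γ v g = 1) :
    g = 1 := by
  have h (T : Set V) : racgRetract Γ T g = 1 := by
    induction T, T.toFinite using Set.Finite.induction_on with
    | empty =>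
      have : racgRetract Γ ∅ = 1 := racg_hom_ext fun s => by simp [racgRetract]
      rw [this, MonoidHom.one_apply]
    | insert hv _ ih => exact racgRetract_insert_eq_one Γ hv g hg (hsign _) ih
  have huniv : racgRetract Γ Set.univ = MonoidHom.id _ :=
    racg_hom_ext fun s => by simp [racgRetract]
  simpa [huniv] using h Set.univ

/-- A right-angled Coxeter group has no elements of order four. -/
theorem racg_pow_two_eq_one_of_pow_four {V : Type*} [Finite V] (Γ : SimpleGraph V)
    (g : (racgMatrix Γ).Group) (hg : g ^ 4 = 1) : g ^ 2 = 1 := by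
  refine racg_eq_one_of_mul_self Γ _ (by rw [← pow_add, hg]) fun v => ?_
  rw [pow_two, map_mul, Int.units_mul_self]

/-- If `φ` is the transvection of `W_Γ` with acting letter `a` and domain `d`, then
`G = W_Γ ⋊_φ ℤ/2ℤ` admits no injective homomorphism into any right-angled Coxeter group;
in particular `G` is not isomorphic to any right-angled Coxeter group. -/
theorem semidirect_by_transvection_not_embed_RACG {V : Type*} [Fintype V]
    (Γ : SimpleGraph V) (a d : V) (had : a ≠ d)
    (hstar : graphStar Γ d ⊆ graphStar Γ a)
    (φ : MulAut (racgMatrix Γ).Group)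
    (hφ₁ : φ ((racgMatrix Γ).simple d) = (racgMatrix Γ).simple d * (racgMatrix Γ).simple a)
    (hφ₂ : ∀ s : V, s ≠ d → φ ((racgMatrix Γ).simple s) = (racgMatrix Γ).simple s)
    (ψ : Multiplicative (ZMod 2) →* MulAut (racgMatrix Γ).Group)
    (hψ : ψ (Multiplicative.ofAdd (1 : ZMod 2)) = φ)
    {V' : Type*} [Fintype V'] (Δ : SimpleGraph V') :
    (∀ f : ((racgMatrix Γ).Group ⋊[ψ] Multiplicative (ZMod 2)) →* (racgMatrix Δ).Group,
      ¬ Function.Injective f) ∧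
    IsEmpty (((racgMatrix Γ).Group ⋊[ψ] Multiplicative (ZMod 2)) ≃* (racgMatrix Δ).Group) := by
  have hinj : ∀ f : ((racgMatrix Γ).Group ⋊[ψ] Multiplicative (ZMod 2)) →* (racgMatrix Δ).Group,
      ¬ Function.Injective f := by
    intro f hf
    let x : (racgMatrix Γ).Group ⋊[ψ] Multiplicative (ZMod 2) :=
      ⟨(racgMatrix Γ).simple d, Multiplicative.ofAdd 1⟩
    have hx : x ^ 2 = SemidirectProduct.inl ((racgMatrix Γ).simple a) := by
      rw [pow_two]
      apply SemidirectProduct.ext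
      · simp [x, hψ, hφ₁, ← mul_assoc, racg_simple_mul_self]
      · exact (by decide : Multiplicative.ofAdd (1 : ZMod 2) * Multiplicative.ofAdd 1 = 1)
    have hx4 : x ^ 4 = 1 := by
      rw [show 4 = 2 * 2 from rfl, pow_mul, hx, pow_two, ← map_mul, racg_simple_mul_self, map_one]
    have hfx : f (x ^ 2) = 1 := by
      rw [map_pow]
      exact racg_pow_two_eq_one_of_pow_four Δ _ (by rw [← map_pow, hx4, map_one])
    have hx2 : x ^ 2 = 1 := hf (hfx.trans f.map_one.symm)
    rw [hx] at hx2
    exact racg_simple_ne_one Γ a (SemidirectProduct.inl_injective (hx2.trans (map_one _).symm))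
  exact ⟨hinj, ⟨fun e => hinj e.toMonoidHom e.injective⟩⟩
end

section
/- Let Γ be a finite simple graph with vertex set S, let a, d ∈ S be distinct vertices with St(d) ⊆ St(a), let φ be the transvection with acting letter a and domain d, and suppose a lies in the center of W_Γ. Let G = W_Γ ⋊_φ (ℤ/2ℤ) with z the image in G of the generator of ℤ/2ℤ. Let h_a, h_d : W_Γ → ℤ/2ℤ be the homomorphisms sending exactly the generator a (respectively d) to 1 and all other generators to 0, let U = ker h_a, and identify W_Γ (hence U) with its image in G. Then there exists an injective group homomorphism Φ : G → Perm(U × ℤ) (the group of permutations of the set U × ℤ) such that: for every u' ∈ U, Φ(u')(u, i) = (u'u, i); Φ(a)(u, i) = (u, -i); and Φ(z)(u, i) = (u, i) when h_d(u) = 0 and Φ(z)(u, i) = (u, -i) when h_d(u) = 1. -/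
/-- The homomorphism from `ℤ/2ℤ` sending the generator to an involution `g`. -/
def involutionHom {M : Type*} [Monoid M] (g : M) (hg : g * g = 1) :
    Multiplicative (ZMod 2) →* M where
  toFun x := if x = 1 then 1 else g
  map_one' := if_pos rfl
  map_mul' x y := by
    have key : ∀ x y : Multiplicative (ZMod 2),
        (x = 1 ∨ y = 1) ∨ (x ≠ 1 ∧ y ≠ 1 ∧ x * y = 1) := by decide
    rcases key x y with (rfl | rfl) | ⟨hx, hy, hxy⟩
    · simp
    · simp
    · simp [hx, hy, hxy, hg]

@[simp]
theorem involutionHom_ofAdd_one {M : Type*} [Monoid M] (g : M) (hg : g * g = 1) :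
    involutionHom g hg (Multiplicative.ofAdd 1) = g :=
  show (if (Multiplicative.ofAdd 1 : Multiplicative (ZMod 2)) = 1 then 1 else g) = g from
    if_neg (by decide)

theorem eq_one_or_eq_ofAdd_one (x : Multiplicative (ZMod 2)) :
    x = 1 ∨ x = Multiplicative.ofAdd 1 := by
  revert x; decide

/-- The sign homomorphism from `ℤ/2ℤ` to the integers. -/
def zmodTwoSign : Multiplicative (ZMod 2) →* ℤ :=
  involutionHom (-1) (by norm_num)

@[simp]
theorem zmodTwoSign_ofAdd_one : zmodTwoSign (Multiplicative.ofAdd 1) = -1 :=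
  involutionHom_ofAdd_one _ _

theorem zmodTwoSign_mul_self (x : Multiplicative (ZMod 2)) :
    zmodTwoSign x * zmodTwoSign x = 1 := by
  rcases eq_one_or_eq_ofAdd_one x with rfl | rfl <;> simp

section CentralInvolution

variable {W : Type*} [Group W] {a : W} (haa : a * a = 1) (hcent : a ∈ Subgroup.center W)
  {ha hd : W →* Multiplicative (ZMod 2)} (hha : ha a = Multiplicative.ofAdd 1)

/-- The endomorphism `w ↦ w * a ^ h w` of `W` defined by a central involution `a`. -/
def centralTwist (h : W →* Multiplicative (ZMod 2)) : W →* W where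
  toFun w := w * involutionHom a haa (h w)
  map_one' := by simp
  map_mul' v w := by
    have hc : w * involutionHom a haa (h v) = involutionHom a haa (h v) * w := by
      rcases eq_one_or_eq_ofAdd_one (h v) with hv | hv
      · simp [hv]
      · simpa [hv] using Subgroup.mem_center_iff.1 hcent w
    simp only [map_mul, mul_assoc]
    rw [← mul_assoc w, hc, mul_assoc]

theorem centralTwist_apply (h : W →* Multiplicative (ZMod 2)) (w : W) :
    centralTwist haa hcent h w = w * involutionHom a haa (h w) :=
  rfl

/-- The projection of `W` onto the kernel of `ha` along a central involution `a`. -/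
def kerProjection : W →* ha.ker :=
  (centralTwist haa hcent ha).codRestrict ha.ker fun w => by
    rw [MonoidHom.mem_ker, centralTwist_apply, map_mul]
    rcases eq_one_or_eq_ofAdd_one (ha w) with h | h
    · simp [h]
    · rw [h, involutionHom_ofAdd_one, hha]; decide

theorem coe_kerProjection (w : W) :
    (kerProjection haa hcent hha w : W) = w * involutionHom a haa (ha w) :=
  rfl

theorem kerProjection_coe (u : ha.ker) : kerProjection haa hcent hha (u : W) = u := by
  ext
  simp [coe_kerProjection, MonoidHom.mem_ker.1 u.2]

theorem kerProjection_self : kerProjection haa hcent hha a = 1 := by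
  ext
  simp [coe_kerProjection, hha, haa]

/-- The action of `W` on `ker ha × ℤ` in which the kernel translates the first factor and
the central involution `a` negates the second. -/
def kerProdAction : W →* Equiv.Perm (ha.ker × ℤ) :=
  MonoidHom.toHomPerm
    { toFun := fun w x => (kerProjection haa hcent hha w * x.1, zmodTwoSign (ha w) * x.2)
      map_one' := by
        funext x
        show _ = x
        simp
      map_mul' := fun v w => by
        funext x
        show _ = (_ * (_ * _), _ * (_ * _))
        simp [mul_assoc] }

theorem kerProdAction_apply (w : W) (x : ha.ker × ℤ) :
    kerProdAction haa hcent hha w x =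
      (kerProjection haa hcent hha w * x.1, zmodTwoSign (ha w) * x.2) :=
  rfl

variable (ha hd) in
/-- The permutation of `ker ha × ℤ` negating the second coordinate where `hd` is nontrivial. -/
def signTwist : Equiv.Perm (ha.ker × ℤ) :=
  Function.Involutive.toPerm (fun x => (x.1, zmodTwoSign (hd x.1) * x.2)) fun x => by
    simp [← mul_assoc, zmodTwoSign_mul_self]

theorem signTwist_apply (x : ha.ker × ℤ) :
    signTwist ha hd x = (x.1, zmodTwoSign (hd x.1) * x.2) :=
  rfl

theorem signTwist_mul_self : signTwist ha hd * signTwist ha hd = 1 := by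
  ext x <;> simp [signTwist_apply, ← mul_assoc, zmodTwoSign_mul_self]

/-- A semidirect product of `W` by the transvection `w ↦ w * a ^ hd w`, for a central
involution `a`, acts faithfully on `ker ha × ℤ`. -/
theorem exists_faithful_action_of_central_involution (hda : hd a = 1) {d : W} (had : ha d = 1)
    (hdd : hd d = Multiplicative.ofAdd 1) (ψ : Multiplicative (ZMod 2) →* MulAut W)
    (hψ : ∀ w, ψ (Multiplicative.ofAdd 1) w = centralTwist haa hcent hd w) :
    ∃ Φ : (W ⋊[ψ] Multiplicative (ZMod 2)) →* Equiv.Perm (ha.ker × ℤ),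
      Function.Injective Φ ∧
      (∀ w x, Φ (SemidirectProduct.inl w) x = kerProdAction haa hcent hha w x) ∧
      ∀ x, Φ (SemidirectProduct.inr (Multiplicative.ofAdd 1)) x = signTwist ha hd x := by
  have hcompat : ∀ k, (kerProdAction haa hcent hha).comp (ψ k).toMonoidHom =
      (MulAut.conj (involutionHom (signTwist ha hd) signTwist_mul_self k)).toMonoidHom.comp
        (kerProdAction haa hcent hha) := by
    intro k
    rcases eq_one_or_eq_ofAdd_one k with rfl | rfl
    · ext w x <;> simp
    refine MonoidHom.ext fun w => ?_
    simp only [MonoidHom.comp_apply, MulEquiv.coe_toMonoidHom, MulAut.conj_apply,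
      involutionHom_ofAdd_one, hψ, centralTwist_apply]
    rw [eq_mul_inv_iff_mul_eq]
    have hp : hd (kerProjection haa hcent hha w : W) = hd w := by
      rcases eq_one_or_eq_ofAdd_one (ha w) with h | h <;> simp [coe_kerProjection, h, hda]
    refine Equiv.ext fun x => ?_
    simp only [Equiv.Perm.mul_apply, signTwist_apply, kerProdAction_apply, map_mul,
      Subgroup.coe_mul, hp]
    rcases eq_one_or_eq_ofAdd_one (hd w) with h | h
    · simp [h]; ring
    · simp [h, hha, kerProjection_self]; ring
  refine ⟨SemidirectProduct.lift _ _ hcompat, ?_, fun w x => by simp, fun x => by simp⟩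
  rw [injective_iff_map_eq_one]
  rintro ⟨w, k⟩ h
  rw [SemidirectProduct.mk_eq_inl_mul_inr, map_mul, SemidirectProduct.lift_inl,
    SemidirectProduct.lift_inr] at h
  have hfix : ∀ x, kerProdAction haa hcent hha w
      (involutionHom (signTwist ha hd) signTwist_mul_self k x) = x := fun x =>
    DFunLike.congr_fun h x
  have hone : kerProdAction haa hcent hha w (1, 1) = (1, 1) := by
    have := hfix (1, 1)
    rcases eq_one_or_eq_ofAdd_one k with rfl | rfl
    · simpa using this
    · simpa [signTwist_apply] using this
  have hw : ha w = 1 := by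
    rcases eq_one_or_eq_ofAdd_one (ha w) with h | h
    · exact h
    · simp [kerProdAction_apply, h] at hone
  have hw1 : w = 1 := by
    have := congrArg (fun x : ha.ker × ℤ => (x.1 : W)) hone
    simpa [kerProdAction_apply, coe_kerProjection, hw] using this
  subst hw1
  rcases eq_one_or_eq_ofAdd_one k with rfl | rfl
  · rfl
  · have := hfix (⟨d, had⟩, 1)
    simp [signTwist_apply, hdd] at this

end CentralInvolution

/-- Suppose `φ` is the transvection of `W_Γ` with acting letter `a` and domain `d`, the
generator `a` is central in `W_Γ`, `G = W_Γ ⋊_φ ℤ/2ℤ` with `z` the generator of the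
`ℤ/2ℤ` factor, and `U = ker h_a ≤ W_Γ`.  Then there is an injective homomorphism
`Φ : G → Perm(U × ℤ)` with `Φ(u')(u, i) = (u'u, i)` for `u' ∈ U`, `Φ(a)(u, i) = (u, -i)`,
and `Φ(z)(u, i) = (u, i)` or `(u, -i)` according as `h_d(u) = 0` or `h_d(u) = 1`. -/
theorem transvection_central_faithful_action {V : Type*} [Fintype V] (Γ : SimpleGraph V)
    (a d : V) (had : a ≠ d) (hstar : graphStar Γ d ⊆ graphStar Γ a)
    (φ : MulAut (racgMatrix Γ).Group)
    (hφ₁ : φ ((racgMatrix Γ).simple d) = (racgMatrix Γ).simple d * (racgMatrix Γ).simple a)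
    (hφ₂ : ∀ s : V, s ≠ d → φ ((racgMatrix Γ).simple s) = (racgMatrix Γ).simple s)
    (hcent : (racgMatrix Γ).simple a ∈ Subgroup.center (racgMatrix Γ).Group)
    (ψ : Multiplicative (ZMod 2) →* MulAut (racgMatrix Γ).Group)
    (hψ : ψ (Multiplicative.ofAdd (1 : ZMod 2)) = φ)
    (ha hd : (racgMatrix Γ).Group →* Multiplicative (ZMod 2))
    (hha₁ : ha ((racgMatrix Γ).simple a) = Multiplicative.ofAdd (1 : ZMod 2))
    (hha₂ : ∀ s : V, s ≠ a → ha ((racgMatrix Γ).simple s) = 1)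
    (hhd₁ : hd ((racgMatrix Γ).simple d) = Multiplicative.ofAdd (1 : ZMod 2))
    (hhd₂ : ∀ s : V, s ≠ d → hd ((racgMatrix Γ).simple s) = 1) :
    ∃ Φ : ((racgMatrix Γ).Group ⋊[ψ] Multiplicative (ZMod 2)) →*
        Equiv.Perm (ha.ker × ℤ),
      Function.Injective Φ ∧
      (∀ (u' u : ha.ker) (i : ℤ),
        Φ (SemidirectProduct.inl (u' : (racgMatrix Γ).Group)) (u, i) = (u' * u, i)) ∧
      (∀ (u : ha.ker) (i : ℤ),
        Φ (SemidirectProduct.inl ((racgMatrix Γ).simple a)) (u, i) = (u, -i)) ∧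
      (∀ (u : ha.ker) (i : ℤ), hd (u : (racgMatrix Γ).Group) = 1 →
        Φ (SemidirectProduct.inr (Multiplicative.ofAdd (1 : ZMod 2))) (u, i) = (u, i)) ∧
      (∀ (u : ha.ker) (i : ℤ),
        hd (u : (racgMatrix Γ).Group) = Multiplicative.ofAdd (1 : ZMod 2) →
        Φ (SemidirectProduct.inr (Multiplicative.ofAdd (1 : ZMod 2))) (u, i) = (u, -i)) := by
  have haa := (racgMatrix Γ).toCoxeterSystem.simple_mul_simple_self a
  rw [CoxeterMatrix.toCoxeterSystem_simple] at haa
  have hind {N : Type _} [MulOneClass N] {f g : (racgMatrix Γ).Group →* N}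
      (h : ∀ s, f ((racgMatrix Γ).simple s) = g ((racgMatrix Γ).simple s)) : f = g :=
    (racgMatrix Γ).toCoxeterSystem.ext_simple (by simpa using h)
  have hda := hhd₂ a had
  have hφ : φ.toMonoidHom = centralTwist haa hcent hd := hind fun s => by
    by_cases hs : s = d
    · subst hs
      simpa [centralTwist_apply, hhd₁] using hφ₁
    · simpa [centralTwist_apply, hhd₂ s hs] using hφ₂ s hs
  obtain ⟨Φ, hinj, hl, hr⟩ := exists_faithful_action_of_central_involution haa hcent hha₁ hda
    (hha₂ d had.symm) hhd₁ ψ fun w => by rw [hψ]; exact DFunLike.congr_fun hφ w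
  refine ⟨Φ, hinj, fun u' u i => ?_, fun u i => ?_, fun u i hu => ?_, fun u i hu => ?_⟩
  · rw [hl, kerProdAction_apply, kerProjection_coe, MonoidHom.mem_ker.1 u'.2]
    simp
  · simp [hl, kerProdAction_apply, kerProjection_self, hha₁]
  · simp [hr, signTwist_apply, hu]
  · simp [hr, signTwist_apply, hu]
end
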